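/- Let G be the subgroup of 4×4 complex unitary matrices generated by Λ₁(σ_x^{1/2}), Λ₁(σ_z^{1/2}), and the swap matrix S. Then the topological closure of G contains every 4×4 unitary matrix W of the block form diag(1, V) where V is a 3×3 unitary matrix of determinant 1; that is, every W with W₀₀ = 1, W₀ⱼ = Wⱼ₀ = 0 for j ∈ {1,2,3}, and whose lower-right 3×3 block lies in SU(3) can be approximated to arbitrary precision (entrywise) by finite products of the three generators and their inverses. -/

import Mathlib

open Matrix Complex

/-- `Λ₁(σ_x^{1/2})`, where `σ_x^{1/2} = H σ_z^{1/2} H = (1/2)[[1+i,1-i],[1-i,1+i]]`. -/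
noncomputable def cSqrtX : Matrix (Fin 4) (Fin 4) ℂ :=
  !![1, 0, 0, 0;
     0, 1, 0, 0;
     0, 0, (1 + Complex.I) / 2, (1 - Complex.I) / 2;
     0, 0, (1 - Complex.I) / 2, (1 + Complex.I) / 2]

/-- `Λ₁(σ_z^{1/2})`. -/
noncomputable def cSqrtZ : Matrix (Fin 4) (Fin 4) ℂ :=
  !![1, 0, 0, 0;
     0, 1, 0, 0;
     0, 0, 1, 0;
     0, 0, 0, Complex.I]

/-- The swap gate, with basis indexed by pairs `(a,b) ↦ 2a+b`. -/
noncomputable def swapGate : Matrix (Fin 4) (Fin 4) ℂ :=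
  !![1, 0, 0, 0;
     0, 0, 1, 0;
     0, 1, 0, 0;
     0, 0, 0, 1]


open Filter Topology in
/-- The power map is Lipschitz on balls. -/
lemma norm_pow_sub_pow_le_of_norm_le {𝔸 : Type*} [NormedRing 𝔸] [NormOneClass 𝔸] {x y : 𝔸} {C : ℝ}
    (hC : 1 ≤ C) (hx : ‖x‖ ≤ C) (hy : ‖y‖ ≤ C) (n : ℕ) :
    ‖x ^ n - y ^ n‖ ≤ n * C ^ n * ‖x - y‖ := by
  induction n with
  | zero => simp
  | succ n ih =>
    have hxn : ‖x ^ n‖ ≤ C ^ n := (norm_pow_le x n).trans (by gcongr)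
    have hCn : C ^ n ≤ C ^ (n + 1) := pow_le_pow_right₀ hC n.le_succ
    calc ‖x ^ (n + 1) - y ^ (n + 1)‖
        = ‖x ^ n * (x - y) + (x ^ n - y ^ n) * y‖ := by
          rw [pow_succ, pow_succ]; congr 1; noncomm_ring
      _ ≤ ‖x ^ n‖ * ‖x - y‖ + ‖x ^ n - y ^ n‖ * ‖y‖ :=
          (norm_add_le _ _).trans (add_le_add (norm_mul_le _ _) (norm_mul_le _ _))
      _ ≤ C ^ n * ‖x - y‖ + n * C ^ n * ‖x - y‖ * C := by gcongr
      _ ≤ C ^ (n + 1) * ‖x - y‖ + n * C ^ n * ‖x - y‖ * C := by gcongr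
      _ = (n + 1 : ℕ) * C ^ (n + 1) * ‖x - y‖ := by push_cast; ring

open Filter Topology in
/-- Two curves through `1` with the same velocity have asymptotically equal powers
`γ (1 / n) ^ n`. -/
lemma tendsto_pow_sub_pow_of_hasDerivAt {𝔸 : Type*} [NormedRing 𝔸] [NormOneClass 𝔸]
    [NormedAlgebra ℝ 𝔸] {γ δ : ℝ → 𝔸} {A : 𝔸} (hγ₀ : γ 0 = 1) (hδ₀ : δ 0 = 1)
    (hγ : HasDerivAt γ A 0) (hδ : HasDerivAt δ A 0) :
    Tendsto (fun n : ℕ => γ (1 / ((n : ℝ) + 1)) ^ (n + 1) - δ (1 / ((n : ℝ) + 1)) ^ (n + 1))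
      atTop (𝓝 0) := by
  have hlim : Tendsto (fun n : ℕ => 1 / ((n : ℝ) + 1)) atTop (𝓝[≠] 0) :=
    tendsto_nhdsWithin_iff.2 ⟨tendsto_one_div_add_atTop_nhds_zero_nat,
      Eventually.of_forall fun n => (Nat.one_div_pos_of_nat (α := ℝ)).ne'⟩
  have hslope {ε : ℝ → 𝔸} (hε₀ : ε 0 = 1) (hε : HasDerivAt ε A 0) :
      Tendsto (fun n : ℕ => ((n : ℝ) + 1) • (ε (1 / ((n : ℝ) + 1)) - 1)) atTop (𝓝 A) := by
    refine ((hasDerivAt_iff_tendsto_slope_zero.1 hε).comp hlim).congr fun n => ?_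
    simp [hε₀]
  have hbound {ε : ℝ → 𝔸} (hε₀ : ε 0 = 1) (hε : HasDerivAt ε A 0) :
      ∀ᶠ n : ℕ in atTop, ‖ε (1 / ((n : ℝ) + 1))‖ ≤ Real.exp ((‖A‖ + 1) / ((n : ℝ) + 1)) := by
    filter_upwards [(hslope hε₀ hε).norm.eventually_le_const (lt_add_one _)] with n hn
    rw [norm_smul, Real.norm_of_nonneg (by positivity), ← le_div_iff₀' (by positivity)] at hn
    calc ‖ε (1 / ((n : ℝ) + 1))‖ = ‖(ε (1 / ((n : ℝ) + 1)) - 1) + 1‖ := by simp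
      _ ≤ ‖ε (1 / ((n : ℝ) + 1)) - 1‖ + 1 := (norm_add_le _ _).trans_eq (by rw [norm_one])
      _ ≤ (‖A‖ + 1) / ((n : ℝ) + 1) + 1 := by gcongr
      _ ≤ _ := Real.add_one_le_exp _
  refine squeeze_zero_norm' (a := fun n : ℕ => Real.exp (‖A‖ + 1) *
    ‖((n : ℝ) + 1) • (γ (1 / ((n : ℝ) + 1)) - 1) -
      ((n : ℝ) + 1) • (δ (1 / ((n : ℝ) + 1)) - 1)‖) ?_ ?_
  · filter_upwards [hbound hγ₀ hγ, hbound hδ₀ hδ] with n hx hy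
    refine (norm_pow_sub_pow_le_of_norm_le (Real.one_le_exp (by positivity)) hx hy _).trans
      (le_of_eq ?_)
    rw [← smul_sub, norm_smul, Real.norm_of_nonneg (by positivity), ← Real.exp_nat_mul,
      sub_sub_sub_cancel_right]
    have : ((n + 1 : ℕ) : ℝ) * ((‖A‖ + 1) / ((n : ℝ) + 1)) = ‖A‖ + 1 := by
      push_cast; field_simp
    rw [this]; push_cast; ring
  · simpa using ((hslope hγ₀ hγ).sub (hslope hδ₀ hδ)).norm.const_mul (Real.exp (‖A‖ + 1))

/-- `A` is the velocity at `1` of a differentiable curve contained in the monoid `S`. -/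
def IsTangent {𝔸 : Type*} [NormedRing 𝔸] [NormedAlgebra ℝ 𝔸] (S : Submonoid 𝔸) (A : 𝔸) : Prop :=
  ∃ γ : ℝ → 𝔸, (∀ t, γ t ∈ S) ∧ γ 0 = 1 ∧ HasDerivAt γ A 0

namespace IsTangent

variable {𝔸 : Type*} [NormedRing 𝔸] [NormedAlgebra ℝ 𝔸] {S : Submonoid 𝔸} {A B : 𝔸}

lemma add (hA : IsTangent S A) (hB : IsTangent S B) : IsTangent S (A + B) := by
  obtain ⟨γ, hγ, hγ₀, hγ'⟩ := hA
  obtain ⟨δ, hδ, hδ₀, hδ'⟩ := hB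
  exact ⟨fun t => γ t * δ t, fun t => S.mul_mem (hγ t) (hδ t), by simp [hγ₀, hδ₀],
    by simpa [hγ₀, hδ₀] using hγ'.fun_mul hδ'⟩

lemma smul (c : ℝ) (hA : IsTangent S A) : IsTangent S (c • A) := by
  obtain ⟨γ, hγ, hγ₀, hγ'⟩ := hA
  refine ⟨fun t => γ (c * t), fun t => hγ _, by simp [hγ₀], ?_⟩
  have h : HasDerivAt (fun t : ℝ => c * t) c 0 := by
    simpa using (hasDerivAt_id (0 : ℝ)).const_mul c
  exact HasDerivAt.scomp (0 : ℝ) (by simpa using hγ') h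

lemma conj {u v : 𝔸} (hu : u ∈ S) (hv : v ∈ S) (huv : u * v = 1) (hA : IsTangent S A) :
    IsTangent S (u * A * v) := by
  obtain ⟨γ, hγ, hγ₀, hγ'⟩ := hA
  exact ⟨fun t => u * γ t * v, fun t => S.mul_mem (S.mul_mem hu (hγ t)) hv, by simp [hγ₀, huv],
    (hγ'.const_mul u).mul_const v⟩

open Filter in
/-- A closed monoid contains the one-parameter groups generated by its tangent vectors. -/
lemma one_parameter_mem [NormOneClass 𝔸] (hS : IsClosed (S : Set 𝔸)) (hA : IsTangent S A)
    {δ : ℝ → 𝔸} (hδ₀ : δ 0 = 1) (hδ_add : ∀ s t, δ (s + t) = δ s * δ t)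
    (hδ : HasDerivAt δ A 0) (t : ℝ) : δ t ∈ S := by
  have hpow (n : ℕ) (s : ℝ) : δ s ^ n = δ (n * s) := by
    induction n with
    | zero => simp [hδ₀]
    | succ n ih => rw [pow_succ, ih, ← hδ_add]; congr 1; push_cast; ring
  obtain ⟨γ, hγ, hγ₀, hγ'⟩ := hA.smul t
  have hδt : HasDerivAt (fun s => δ (t * s)) (t • A) 0 := by
    have h : HasDerivAt (fun s : ℝ => t * s) t 0 := by
      simpa using (hasDerivAt_id (0 : ℝ)).const_mul t
    exact HasDerivAt.scomp (0 : ℝ) (by simpa using hδ) h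
  have hlim := tendsto_pow_sub_pow_of_hasDerivAt hγ₀ (by simp [hδ₀]) hγ' hδt
  have hconst (n : ℕ) : δ (t * (1 / ((n : ℝ) + 1))) ^ (n + 1) = δ t := by
    rw [hpow]; congr 1; push_cast; field_simp
  simp only [hconst] at hlim
  refine hS.mem_of_tendsto (by simpa using hlim.add_const (δ t))
    (Eventually.of_forall fun n => S.pow_mem (hγ _) _)

end IsTangent

/-- The rotation curve `1 + (cos t - 1) P + sin t K`; it is a one-parameter group when `P` is
idempotent and `K` is a square root of `-P` in the corner `P 𝔸 P`. -/
noncomputable def rotationCurve {𝔸 : Type*} [Ring 𝔸] [Algebra ℝ 𝔸] (P K : 𝔸) (t : ℝ) : 𝔸 :=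
  1 + (Real.cos t - 1) • P + Real.sin t • K

section rotationCurve

lemma rotationCurve_zero {𝔸 : Type*} [Ring 𝔸] [Algebra ℝ 𝔸] (P K : 𝔸) :
    rotationCurve P K 0 = 1 := by
  simp [rotationCurve]

lemma rotationCurve_add {𝔸 : Type*} [Ring 𝔸] [Algebra ℝ 𝔸] {P K : 𝔸} (hPP : P * P = P)
    (hPK : P * K = K) (hKP : K * P = K) (hKK : K * K = -P) (s t : ℝ) :
    rotationCurve P K (s + t) = rotationCurve P K s * rotationCurve P K t := by
  simp only [rotationCurve, mul_add, add_mul, smul_mul_smul_comm, hPP, hPK, hKP, hKK, mul_one,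
    one_mul, Real.cos_add, Real.sin_add]
  module

lemma hasDerivAt_rotationCurve {𝔸 : Type*} [NormedRing 𝔸] [NormedAlgebra ℝ 𝔸] (P K : 𝔸) :
    HasDerivAt (rotationCurve P K) K 0 := by
  have hc : HasDerivAt (fun t : ℝ => Real.cos t - 1) 0 0 := by
    simpa using (Real.hasDerivAt_cos 0).sub_const 1
  have hs : HasDerivAt Real.sin 1 0 := by simpa using Real.hasDerivAt_sin 0
  unfold rotationCurve
  simpa using ((hc.smul_const P).const_add 1).fun_add (hs.smul_const K)

lemma continuous_rotationCurve {𝔸 : Type*} [NormedRing 𝔸] [NormedAlgebra ℝ 𝔸] (P K : 𝔸) :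
    Continuous (rotationCurve P K) := by
  unfold rotationCurve
  fun_prop

/-- If a closed monoid contains a rotation by an irrational angle and its inverse, then it contains
the whole circle. -/
lemma rotationCurve_mem {𝔸 : Type*} [NormedRing 𝔸] [NormedAlgebra ℝ 𝔸] {S : Submonoid 𝔸}
    (hS : IsClosed (S : Set 𝔸)) {P K : 𝔸} (hPP : P * P = P)
    (hPK : P * K = K) (hKP : K * P = K) (hKK : K * K = -P) {θ : ℝ}
    (hθ : Irrational (θ / (2 * Real.pi))) (h₁ : rotationCurve P K θ ∈ S)
    (h₂ : rotationCurve P K (-θ) ∈ S) (t : ℝ) : rotationCurve P K t ∈ S := by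
  have hadd := rotationCurve_add hPP hPK hKP hKK
  let Γ : AddSubgroup ℝ :=
    { carrier := {t | rotationCurve P K t ∈ S ∧ rotationCurve P K (-t) ∈ S}
      zero_mem' := by simp [rotationCurve_zero]
      add_mem' := fun {a b} ha hb => ⟨hadd a b ▸ S.mul_mem ha.1 hb.1, by
        rw [neg_add, hadd]; exact S.mul_mem ha.2 hb.2⟩
      neg_mem' := fun {a} ha => ⟨ha.2, by simpa using ha.1⟩ }
  have hle : AddSubgroup.closure {θ, 2 * Real.pi} ≤ Γ := by
    refine (AddSubgroup.closure_le Γ).2 (Set.insert_subset ⟨h₁, h₂⟩ (Set.singleton_subset_iff.2 ?_))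
    exact ⟨by simp [rotationCurve], by simp [rotationCurve]⟩
  have hclosed : IsClosed (rotationCurve P K ⁻¹' (S : Set 𝔸)) :=
    hS.preimage (continuous_rotationCurve P K)
  have hdense : Dense (rotationCurve P K ⁻¹' (S : Set 𝔸)) :=
    (dense_addSubgroupClosure_pair_iff.2 hθ).mono fun t ht => (hle ht).1
  have : t ∈ rotationCurve P K ⁻¹' (S : Set 𝔸) := by
    rw [← hclosed.closure_eq, hdense.closure_eq]; trivial
  exact this

end rotationCurve

lemma irrational_arccos_one_fourth_div_two_pi :
    Irrational (Real.arccos (1 / 4) / (2 * Real.pi)) := by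
  rintro ⟨q, hq⟩
  have hcos : Real.cos (Real.arccos (1 / 4)) = 1 / 4 :=
    Real.cos_arccos (by norm_num) (by norm_num)
  have h := niven (θ := Real.arccos (1 / 4))
    ⟨2 * q, by push_cast; rw [hq]; field_simp⟩ ⟨1 / 4, by rw [hcos]; norm_num⟩
  rw [hcos] at h
  norm_num at h

section Gates

lemma cSqrtX_sq : cSqrtX ^ 2 = !![1, 0, 0, 0; 0, 1, 0, 0; 0, 0, 0, 1; 0, 0, 1, 0] := by
  rw [sq]
  ext i j
  fin_cases i <;> fin_cases j <;>
    simp [cSqrtX, mul_apply, Fin.sum_univ_four, Complex.ext_iff] <;> norm_num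

lemma cSqrtX_pow_three : cSqrtX ^ 3 =
    !![1, 0, 0, 0; 0, 1, 0, 0; 0, 0, (1 - I) / 2, (1 + I) / 2; 0, 0, (1 + I) / 2, (1 - I) / 2] := by
  rw [pow_succ, cSqrtX_sq]
  ext i j
  fin_cases i <;> fin_cases j <;> simp [cSqrtX, mul_apply, Fin.sum_univ_four]

lemma cSqrtX_sq_mul_self : cSqrtX ^ 2 * cSqrtX ^ 2 = 1 := by
  rw [cSqrtX_sq]
  ext i j
  fin_cases i <;> fin_cases j <;> simp [mul_apply, Fin.sum_univ_four]

lemma cSqrtZ_sq : cSqrtZ ^ 2 = !![1, 0, 0, 0; 0, 1, 0, 0; 0, 0, 1, 0; 0, 0, 0, -1] := by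
  rw [sq]
  ext i j
  fin_cases i <;> fin_cases j <;> simp [cSqrtZ, mul_apply, Fin.sum_univ_four]

lemma cSqrtZ_sq_mul_self : cSqrtZ ^ 2 * cSqrtZ ^ 2 = 1 := by
  rw [cSqrtZ_sq]
  ext i j
  fin_cases i <;> fin_cases j <;> simp [mul_apply, Fin.sum_univ_four]

lemma cSqrtZ_pow_three : cSqrtZ ^ 3 = !![1, 0, 0, 0; 0, 1, 0, 0; 0, 0, 1, 0; 0, 0, 0, -I] := by
  rw [pow_succ, cSqrtZ_sq]
  ext i j
  fin_cases i <;> fin_cases j <;> simp [cSqrtZ, mul_apply, Fin.sum_univ_four]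

/-- The frame `S Λ₁(σ_x^{1/2}) S Λ₁(σ_x^{1/2})`, which maps the last basis vector to
`(0, 1, 1 - i, i) / 2`. -/
noncomputable def frameGate : Matrix (Fin 4) (Fin 4) ℂ :=
  !![1, 0, 0, 0;
     0, (1 + I) / 2, -I / 2, 1 / 2;
     0, 0, (1 + I) / 2, (1 - I) / 2;
     0, (1 - I) / 2, 1 / 2, I / 2]

lemma frameGate_eq : frameGate = swapGate * cSqrtX * swapGate * cSqrtX := by
  ext i j
  fin_cases i <;> fin_cases j <;>
    simp [frameGate, swapGate, cSqrtX, mul_apply, Fin.sum_univ_four, Complex.ext_iff] <;> norm_num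

lemma frameGate_conjTranspose : frameGateᴴ =
    !![1, 0, 0, 0;
       0, (1 - I) / 2, 0, (1 + I) / 2;
       0, I / 2, (1 - I) / 2, 1 / 2;
       0, 1 / 2, (1 + I) / 2, -I / 2] := by
  ext i j
  fin_cases i <;> fin_cases j <;> simp [frameGate, sub_eq_add_neg]

lemma frameGate_conjTranspose_eq :
    frameGateᴴ = cSqrtX ^ 3 * swapGate * cSqrtX ^ 3 * swapGate := by
  rw [cSqrtX_pow_three, frameGate_conjTranspose]
  ext i j
  fin_cases i <;> fin_cases j <;>
    simp [swapGate, mul_apply, Fin.sum_univ_four, Complex.ext_iff] <;> norm_num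

/-- The product `frameGate * cSqrtZ * frameGateᴴ * cSqrtZ ^ 3` of two order-four reflections,
a rotation by the angle `arccos (1 / 4)`. -/
noncomputable def irrationalGate : Matrix (Fin 4) (Fin 4) ℂ :=
  !![1, 0, 0, 0;
     0, (3 + I) / 4, -1 / 2, (1 - I) / 4;
     0, I / 2, (1 + I) / 2, -I / 2;
     0, (-1 - I) / 4, -I / 2, (1 - 3 * I) / 4]

lemma reflection_eq : frameGate * cSqrtZ * frameGateᴴ =
    !![1, 0, 0, 0;
       0, (3 + I) / 4, -1 / 2, (1 + I) / 4;
       0, I / 2, (1 + I) / 2, 1 / 2;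
       0, (-1 - I) / 4, -I / 2, (3 + I) / 4] := by
  rw [frameGate_conjTranspose]
  ext i j
  fin_cases i <;> fin_cases j <;>
    simp [frameGate, cSqrtZ, mul_apply, Fin.sum_univ_four, Complex.ext_iff] <;> norm_num

lemma irrationalGate_eq :
    irrationalGate = frameGate * cSqrtZ * frameGateᴴ * cSqrtZ ^ 3 := by
  rw [reflection_eq, cSqrtZ_pow_three]
  ext i j
  fin_cases i <;> fin_cases j <;>
    simp [irrationalGate, mul_apply, Fin.sum_univ_four, Complex.ext_iff] <;> norm_num

lemma reflection_inv_eq : frameGate * cSqrtZ ^ 3 * frameGateᴴ =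
    !![1, 0, 0, 0;
       0, (3 - I) / 4, -I / 2, (-1 + I) / 4;
       0, -1 / 2, (1 - I) / 2, I / 2;
       0, (1 - I) / 4, 1 / 2, (3 - I) / 4] := by
  rw [cSqrtZ_pow_three, frameGate_conjTranspose]
  ext i j
  fin_cases i <;> fin_cases j <;>
    simp [frameGate, mul_apply, Fin.sum_univ_four, Complex.ext_iff] <;> norm_num

lemma irrationalGate_conjTranspose_eq :
    irrationalGateᴴ = cSqrtZ * (frameGate * cSqrtZ ^ 3 * frameGateᴴ) := by
  rw [reflection_inv_eq]
  ext i j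
  fin_cases i <;> fin_cases j <;>
    simp [irrationalGate, cSqrtZ, mul_apply, Fin.sum_univ_four, Complex.ext_iff] <;> norm_num

/-- The projection onto the plane in which `irrationalGate` rotates. -/
noncomputable def rotationPlane : Matrix (Fin 4) (Fin 4) ℂ :=
  !![0, 0, 0, 0;
     0, 1 / 3, (1 + I) / 3, 0;
     0, (1 - I) / 3, 2 / 3, 0;
     0, 0, 0, 1]

/-- The skew-Hermitian part of `irrationalGate`. -/
noncomputable def skewPart : Matrix (Fin 4) (Fin 4) ℂ :=
  !![0, 0, 0, 0;
     0, I / 4, (-1 + I) / 4, (1 - I) / 4;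
     0, (1 + I) / 4, I / 2, -I / 2;
     0, (-1 - I) / 4, -I / 2, -3 * I / 4]

lemma rotationPlane_mul_self : rotationPlane * rotationPlane = rotationPlane := by
  ext i j
  fin_cases i <;> fin_cases j <;>
    simp [rotationPlane, mul_apply, Fin.sum_univ_four, Complex.ext_iff] <;> norm_num

lemma rotationPlane_mul_skewPart : rotationPlane * skewPart = skewPart := by
  ext i j
  fin_cases i <;> fin_cases j <;>
    simp [rotationPlane, skewPart, mul_apply, Fin.sum_univ_four, Complex.ext_iff] <;> norm_num

lemma skewPart_mul_rotationPlane : skewPart * rotationPlane = skewPart := by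
  ext i j
  fin_cases i <;> fin_cases j <;>
    simp [rotationPlane, skewPart, mul_apply, Fin.sum_univ_four, Complex.ext_iff] <;> norm_num

lemma skewPart_mul_self : skewPart * skewPart = -((15 / 16 : ℝ) • rotationPlane) := by
  ext i j
  fin_cases i <;> fin_cases j <;>
    simp [rotationPlane, skewPart, mul_apply, Fin.sum_univ_four, Complex.ext_iff] <;> norm_num

lemma irrationalGate_eq_add :
    irrationalGate = 1 + (1 / 4 - 1 : ℝ) • rotationPlane + skewPart := by
  ext i j
  fin_cases i <;> fin_cases j <;>
    simp [irrationalGate, rotationPlane, skewPart, Complex.ext_iff] <;> norm_num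

lemma irrationalGate_conjTranspose_eq_sub :
    irrationalGateᴴ = 1 + (1 / 4 - 1 : ℝ) • rotationPlane - skewPart := by
  ext i j
  fin_cases i <;> fin_cases j <;>
    simp [irrationalGate, rotationPlane, skewPart, Complex.ext_iff] <;> norm_num

/-- A special unitary `2 × 2` matrix acting on the basis vectors `2, 3`. -/
noncomputable def twoLevel₂₃ (a b : ℂ) : Matrix (Fin 4) (Fin 4) ℂ :=
  !![1, 0, 0, 0; 0, 1, 0, 0; 0, 0, a, b; 0, 0, -star b, star a]

/-- A special unitary `2 × 2` matrix acting on the basis vectors `1, 3`. -/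
noncomputable def twoLevel₁₃ (a b : ℂ) : Matrix (Fin 4) (Fin 4) ℂ :=
  !![1, 0, 0, 0; 0, a, 0, b; 0, 0, 1, 0; 0, -star b, 0, star a]

/-- A special unitary `2 × 2` matrix acting on the basis vectors `1, 2`. -/
noncomputable def twoLevel₁₂ (a b : ℂ) : Matrix (Fin 4) (Fin 4) ℂ :=
  !![1, 0, 0, 0; 0, a, b, 0; 0, -star b, star a, 0; 0, 0, 0, 1]

lemma twoLevel₁₃_eq (a b : ℂ) : twoLevel₁₃ a b = swapGate * twoLevel₂₃ a b * swapGate := by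
  ext i j
  fin_cases i <;> fin_cases j <;>
    simp [twoLevel₁₃, twoLevel₂₃, swapGate, mul_apply, Fin.sum_univ_four]

lemma twoLevel₁₂_eq (a b : ℂ) : twoLevel₁₂ a b = cSqrtX ^ 2 * twoLevel₁₃ a b * cSqrtX ^ 2 := by
  rw [cSqrtX_sq]
  ext i j
  fin_cases i <;> fin_cases j <;>
    simp [twoLevel₁₃, twoLevel₁₂, mul_apply, Fin.sum_univ_four]

/-- The diagonal part of `4 • skewPart`. -/
noncomputable def diagonalVelocity : Matrix (Fin 4) (Fin 4) ℂ :=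
  !![0, 0, 0, 0; 0, I, 0, 0; 0, 0, 2 * I, 0; 0, 0, 0, -3 * I]

lemma diagonalVelocity_eq : diagonalVelocity =
    (skewPart + cSqrtZ ^ 2 * skewPart * cSqrtZ ^ 2) +
      (cSqrtX ^ 2 * cSqrtZ ^ 2 * cSqrtX ^ 2) *
        (skewPart + cSqrtZ ^ 2 * skewPart * cSqrtZ ^ 2) *
        (cSqrtX ^ 2 * cSqrtZ ^ 2 * cSqrtX ^ 2) := by
  have h : cSqrtX ^ 2 * cSqrtZ ^ 2 * cSqrtX ^ 2 =
      !![1, 0, 0, 0; 0, 1, 0, 0; 0, 0, -1, 0; 0, 0, 0, 1] := by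
    rw [cSqrtX_sq, cSqrtZ_sq]
    ext i j
    fin_cases i <;> fin_cases j <;> simp [mul_apply, Fin.sum_univ_four]
  rw [h, cSqrtZ_sq]
  ext i j
  fin_cases i <;> fin_cases j <;>
    simp [diagonalVelocity, skewPart] <;> ring_nf

/-- The velocity of the diagonal torus acting on the basis vectors `2, 3`. -/
noncomputable def torusVelocity : Matrix (Fin 4) (Fin 4) ℂ :=
  !![0, 0, 0, 0; 0, 0, 0, 0; 0, 0, I, 0; 0, 0, 0, -I]

lemma torusVelocity_eq : torusVelocity = (1 / 5 : ℝ) •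
    (diagonalVelocity + (-1 : ℝ) • (cSqrtX ^ 2 * diagonalVelocity * cSqrtX ^ 2)) := by
  rw [cSqrtX_sq]
  ext i j
  fin_cases i <;> fin_cases j <;>
    simp [torusVelocity, diagonalVelocity, Complex.ext_iff] <;>
    norm_num

lemma rotationCurve_torusVelocity (t : ℝ) :
    rotationCurve !![0, 0, 0, 0; 0, 0, 0, 0; 0, 0, 1, 0; 0, 0, 0, 1] torusVelocity t =
      twoLevel₂₃ (Complex.exp (t * I)) 0 := by
  ext i j
  fin_cases i <;> fin_cases j <;>
    simp [rotationCurve, torusVelocity, twoLevel₂₃, Complex.ext_iff, exp_ofReal_mul_I_re,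
      exp_ofReal_mul_I_im] <;>
    exact ⟨rfl, rfl⟩

lemma cSqrtX_conj_twoLevel (t : ℝ) :
    cSqrtX * twoLevel₂₃ (Complex.exp (t * I)) 0 * cSqrtX ^ 3 =
      twoLevel₂₃ (Real.cos t) (-Real.sin t : ℝ) := by
  rw [cSqrtX_pow_three]
  ext i j
  fin_cases i <;> fin_cases j <;>
    simp [cSqrtX, twoLevel₂₃, mul_apply, Fin.sum_univ_four, Complex.ext_iff, exp_ofReal_mul_I_re,
      exp_ofReal_mul_I_im, -ofReal_cos, -ofReal_sin] <;> ring_nf <;> simp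

lemma twoLevel₂₃_euler (α β c s : ℝ) :
    twoLevel₂₃ (Complex.exp (α * I)) 0 * twoLevel₂₃ c s * twoLevel₂₃ (Complex.exp (β * I)) 0 =
      twoLevel₂₃ (c * Complex.exp ((α + β : ℝ) * I)) (s * Complex.exp ((α - β : ℝ) * I)) := by
  ext i j
  fin_cases i <;> fin_cases j <;>
    simp [twoLevel₂₃, mul_apply, Fin.sum_univ_four, ← Complex.exp_conj, add_mul, sub_mul,
      Complex.exp_add, Complex.exp_sub, Complex.exp_neg] <;> ring_nf

open scoped Matrix.Norms.Operator

variable {S : Submonoid (Matrix (Fin 4) (Fin 4) ℂ)}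

/-- A closed monoid containing the three gates contains the rotations in `rotationPlane` obtained
from `irrationalGate`, so that `skewPart` is one of its tangent vectors. -/
lemma isTangent_skewPart (hS : IsClosed (S : Set (Matrix (Fin 4) (Fin 4) ℂ)))
    (hX : cSqrtX ∈ S) (hZ : cSqrtZ ∈ S) (hs : swapGate ∈ S) : IsTangent S skewPart := by
  have hX3 : cSqrtX ^ 3 ∈ S := S.pow_mem hX 3
  have hZ3 : cSqrtZ ^ 3 ∈ S := S.pow_mem hZ 3
  have hF : frameGate ∈ S :=
    frameGate_eq ▸ S.mul_mem (S.mul_mem (S.mul_mem hs hX) hs) hX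
  have hF' : frameGateᴴ ∈ S :=
    frameGate_conjTranspose_eq ▸ S.mul_mem (S.mul_mem (S.mul_mem hX3 hs) hX3) hs
  have hG : irrationalGate ∈ S :=
    irrationalGate_eq ▸ S.mul_mem (S.mul_mem (S.mul_mem hF hZ) hF') hZ3
  have hG' : irrationalGateᴴ ∈ S :=
    irrationalGate_conjTranspose_eq ▸ S.mul_mem hZ (S.mul_mem (S.mul_mem hF hZ3) hF')
  have hcos : Real.cos (Real.arccos (1 / 4)) = 1 / 4 :=
    Real.cos_arccos (by norm_num) (by norm_num)
  have hsin_sq : Real.sin (Real.arccos (1 / 4)) ^ 2 = 15 / 16 := by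
    rw [Real.sin_sq, hcos]; norm_num
  have hsin : Real.sin (Real.arccos (1 / 4)) ≠ 0 := fun h => by
    rw [h] at hsin_sq; norm_num at hsin_sq
  set θ := Real.arccos (1 / 4) with hθ
  have hmem := rotationCurve_mem (S := S) (P := rotationPlane) (K := (Real.sin θ)⁻¹ • skewPart)
    (θ := θ) hS rotationPlane_mul_self
    (by rw [mul_smul_comm, rotationPlane_mul_skewPart])
    (by rw [smul_mul_assoc, skewPart_mul_rotationPlane])
    (by rw [smul_mul_smul_comm, skewPart_mul_self, smul_neg, smul_smul, ← hsin_sq]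
        field_simp
        simp)
    irrational_arccos_one_fourth_div_two_pi
    (by rw [rotationCurve, hcos, smul_inv_smul₀ hsin, ← irrationalGate_eq_add]; exact hG)
    (by rw [rotationCurve, Real.cos_neg, Real.sin_neg, hcos, neg_smul, smul_inv_smul₀ hsin,
          ← sub_eq_add_neg, ← irrationalGate_conjTranspose_eq_sub]; exact hG')
  have h : IsTangent S ((Real.sin θ)⁻¹ • skewPart) :=
    ⟨_, hmem, rotationCurve_zero _ _, hasDerivAt_rotationCurve _ _⟩
  simpa [smul_smul, hsin] using h.smul (Real.sin θ)

lemma isTangent_torusVelocity (hS : IsClosed (S : Set (Matrix (Fin 4) (Fin 4) ℂ)))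
    (hX : cSqrtX ∈ S) (hZ : cSqrtZ ∈ S) (hs : swapGate ∈ S) : IsTangent S torusVelocity := by
  have hX2 : cSqrtX ^ 2 ∈ S := S.pow_mem hX 2
  have hZ2 : cSqrtZ ^ 2 ∈ S := S.pow_mem hZ 2
  have hskew := isTangent_skewPart hS hX hZ hs
  have hsum := hskew.add (hskew.conj hZ2 hZ2 cSqrtZ_sq_mul_self)
  have hXZX := S.mul_mem (S.mul_mem hX2 hZ2) hX2
  have hXZX_sq : (cSqrtX ^ 2 * cSqrtZ ^ 2 * cSqrtX ^ 2) *
      (cSqrtX ^ 2 * cSqrtZ ^ 2 * cSqrtX ^ 2) = 1 := by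
    simp only [mul_assoc]
    rw [← mul_assoc (cSqrtX ^ 2) (cSqrtX ^ 2), cSqrtX_sq_mul_self, one_mul,
      ← mul_assoc (cSqrtZ ^ 2) (cSqrtZ ^ 2), cSqrtZ_sq_mul_self, one_mul, cSqrtX_sq_mul_self]
  have hdiag : IsTangent S diagonalVelocity :=
    diagonalVelocity_eq ▸ hsum.add (hsum.conj hXZX hXZX hXZX_sq)
  exact torusVelocity_eq ▸
    (hdiag.add ((hdiag.conj hX2 hX2 cSqrtX_sq_mul_self).smul (-1))).smul (1 / 5)

lemma twoLevel₂₃_exp_mem (hS : IsClosed (S : Set (Matrix (Fin 4) (Fin 4) ℂ)))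
    (hX : cSqrtX ∈ S) (hZ : cSqrtZ ∈ S) (hs : swapGate ∈ S) (t : ℝ) :
    twoLevel₂₃ (Complex.exp (t * I)) 0 ∈ S := by
  rw [← rotationCurve_torusVelocity]
  refine (isTangent_torusVelocity hS hX hZ hs).one_parameter_mem hS (rotationCurve_zero _ _)
    (rotationCurve_add ?_ ?_ ?_ ?_) (hasDerivAt_rotationCurve _ _) t <;>
  · ext i j
    fin_cases i <;> fin_cases j <;> simp [torusVelocity, mul_apply, Fin.sum_univ_four]

lemma twoLevel₂₃_mem (hS : IsClosed (S : Set (Matrix (Fin 4) (Fin 4) ℂ)))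
    (hX : cSqrtX ∈ S) (hZ : cSqrtZ ∈ S) (hs : swapGate ∈ S) {a b : ℂ}
    (hab : ‖a‖ ^ 2 + ‖b‖ ^ 2 = 1) : twoLevel₂₃ a b ∈ S := by
  have hexp := twoLevel₂₃_exp_mem hS hX hZ hs
  have hcos : Real.cos (-Real.arccos ‖a‖) = ‖a‖ := by
    rw [Real.cos_neg, Real.cos_arccos (by linarith [norm_nonneg a])
      (by nlinarith [sq_nonneg ‖b‖, norm_nonneg a])]
  have hsin : -Real.sin (-Real.arccos ‖a‖) = ‖b‖ := by
    rw [Real.sin_neg, neg_neg, Real.sin_arccos, ← hab, add_sub_cancel_left,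
      Real.sqrt_sq (norm_nonneg b)]
  have hrot := S.mul_mem (S.mul_mem hX (hexp (-Real.arccos ‖a‖))) (S.pow_mem hX 3)
  rw [cSqrtX_conj_twoLevel, hcos, hsin] at hrot
  have h := S.mul_mem (S.mul_mem (hexp ((arg a + arg b) / 2)) hrot) (hexp ((arg a - arg b) / 2))
  rwa [twoLevel₂₃_euler, show (arg a + arg b) / 2 + (arg a - arg b) / 2 = arg a by ring,
    show (arg a + arg b) / 2 - (arg a - arg b) / 2 = arg b by ring, norm_mul_exp_arg_mul_I,
    norm_mul_exp_arg_mul_I] at h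

end Gates

/-- A diagonal entry `1` of a unitary matrix kills the rest of its row and column. -/
lemma Matrix.apply_eq_zero_of_mem_unitaryGroup {n : Type*} [Fintype n] [DecidableEq n]
    {X : Matrix n n ℂ} (hX : X ∈ unitaryGroup n ℂ) {i j : n} (hi : X i i = 1) (hj : j ≠ i) :
    X i j = 0 ∧ X j i = 0 := by
  have key {Y : Matrix n n ℂ} (hY : Y ∈ unitaryGroup n ℂ) (hi : Y i i = 1) : Y i j = 0 := by
    have h := congrArg (fun M => (M i i).re) (mem_unitaryGroup_iff.1 hY)
    simp only [mul_apply, star_apply, one_apply_eq, re_sum, one_re] at h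
    rw [← Finset.add_sum_erase _ _ (Finset.mem_univ i), hi] at h
    have hz : ∑ k ∈ Finset.univ.erase i, (Y i k * star (Y i k)).re = 0 := by simpa using h
    rw [Finset.sum_eq_zero_iff_of_nonneg fun k _ => by
      simp only [star_def, mul_conj, ofReal_re]; exact normSq_nonneg _] at hz
    simpa [mul_conj] using hz j (by simp [hj])
  refine ⟨key hX hi, ?_⟩
  simpa using key (Unitary.star_mem hX) (by simp [hi])

/-- A unit column of a unitary matrix with a single nonzero entry, which is nonnegative. -/
lemma Matrix.apply_eq_one_of_mem_unitaryGroup {n : Type*} [Fintype n] [DecidableEq n]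
    {X : Matrix n n ℂ} (hX : X ∈ unitaryGroup n ℂ) {i : n} {r : ℝ} (hr : 0 ≤ r)
    (hi : X i i = r) (h : ∀ j ≠ i, X j i = 0) : X i i = 1 := by
  have hcol := congrArg (fun M => M i i) (mem_unitaryGroup_iff'.1 hX)
  simp only [mul_apply, star_apply, one_apply_eq] at hcol
  rw [Finset.sum_eq_single i (fun j _ hj => by simp [h j hj]) (by simp), hi] at hcol
  have hr2 : r * r = 1 := by exact_mod_cast (by simpa using hcol : (r : ℂ) * r = 1)
  rw [hi, (by nlinarith : r = 1), ofReal_one]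

/-- Every vector in `ℂ²` can be rotated into the nonnegative second axis. -/
lemma exists_rotation_to_axis (x y : ℂ) : ∃ a b : ℂ, ‖a‖ ^ 2 + ‖b‖ ^ 2 = 1 ∧
    a * x + b * y = 0 ∧ ∃ r : ℝ, 0 ≤ r ∧ -star b * x + star a * y = r := by
  set r := √(‖x‖ ^ 2 + ‖y‖ ^ 2) with hr
  have hr2 : r ^ 2 = ‖x‖ ^ 2 + ‖y‖ ^ 2 := Real.sq_sqrt (by positivity)
  have hr0 : 0 ≤ r := Real.sqrt_nonneg _
  rcases eq_or_ne r 0 with h | h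
  · have hx : x = 0 := by
      rw [← norm_eq_zero, ← sq_eq_zero_iff]
      nlinarith [sq_nonneg ‖x‖, sq_nonneg ‖y‖]
    have hy : y = 0 := by
      rw [← norm_eq_zero, ← sq_eq_zero_iff]
      nlinarith [sq_nonneg ‖x‖, sq_nonneg ‖y‖]
    exact ⟨1, 0, by simp, by simp [hx], 0, le_rfl, by simp [hx, hy]⟩
  · have hrC : (r : ℂ) ≠ 0 := by exact_mod_cast h
    refine ⟨y / r, -x / r, ?_, by ring, r, hr0, ?_⟩
    · simp only [norm_div, norm_neg, norm_real, Real.norm_of_nonneg hr0]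
      field_simp
      linarith
    · have hC : (r : ℂ) ^ 2 = star x * x + star y * y := by
        simp only [star_def, conj_mul']
        exact_mod_cast hr2
      simp only [star_def, map_div₀, map_neg, conj_ofReal] at hC ⊢
      field_simp
      rw [hC]

section Givens

variable {a b : ℂ}

lemma twoLevel₂₃_mul (X : Matrix (Fin 4) (Fin 4) ℂ) : twoLevel₂₃ a b * X =
    of ![X 0, X 1, a • X 2 + b • X 3, -star b • X 2 + star a • X 3] := by
  ext i j
  fin_cases i <;> simp [twoLevel₂₃, mul_apply, Fin.sum_univ_four]

lemma twoLevel₁₃_mul (X : Matrix (Fin 4) (Fin 4) ℂ) : twoLevel₁₃ a b * X =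
    of ![X 0, a • X 1 + b • X 3, X 2, -star b • X 1 + star a • X 3] := by
  ext i j
  fin_cases i <;> simp [twoLevel₁₃, mul_apply, Fin.sum_univ_four]

lemma twoLevel₁₂_mul (X : Matrix (Fin 4) (Fin 4) ℂ) : twoLevel₁₂ a b * X =
    of ![X 0, a • X 1 + b • X 2, -star b • X 1 + star a • X 2, X 3] := by
  ext i j
  fin_cases i <;> simp [twoLevel₁₂, mul_apply, Fin.sum_univ_four]

lemma star_twoLevel₂₃ (a b : ℂ) : star (twoLevel₂₃ a b) = twoLevel₂₃ (star a) (-b) := by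
  ext i j
  fin_cases i <;> fin_cases j <;> simp [twoLevel₂₃]

lemma twoLevel₂₃_mem_specialUnitaryGroup (hab : ‖a‖ ^ 2 + ‖b‖ ^ 2 = 1) :
    twoLevel₂₃ a b ∈ specialUnitaryGroup (Fin 4) ℂ := by
  have h : starRingEnd ℂ a * a + starRingEnd ℂ b * b = 1 := by
    simp only [conj_mul']; exact_mod_cast hab
  refine mem_specialUnitaryGroup_iff.2 ⟨mem_unitaryGroup_iff'.2 ?_, ?_⟩
  · rw [star_twoLevel₂₃, twoLevel₂₃_mul]
    ext i j
    fin_cases i <;> fin_cases j <;> simp [twoLevel₂₃] <;>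
      first | ring1 | linear_combination h
  · simp [twoLevel₂₃, det_succ_row_zero, Fin.sum_univ_succ, Fin.succAbove]
    linear_combination h

lemma star_twoLevel₁₃ (a b : ℂ) : star (twoLevel₁₃ a b) = twoLevel₁₃ (star a) (-b) := by
  ext i j
  fin_cases i <;> fin_cases j <;> simp [twoLevel₁₃]

lemma twoLevel₁₃_mem_specialUnitaryGroup (hab : ‖a‖ ^ 2 + ‖b‖ ^ 2 = 1) :
    twoLevel₁₃ a b ∈ specialUnitaryGroup (Fin 4) ℂ := by
  have h : starRingEnd ℂ a * a + starRingEnd ℂ b * b = 1 := by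
    simp only [conj_mul']; exact_mod_cast hab
  refine mem_specialUnitaryGroup_iff.2 ⟨mem_unitaryGroup_iff'.2 ?_, ?_⟩
  · rw [star_twoLevel₁₃, twoLevel₁₃_mul]
    ext i j
    fin_cases i <;> fin_cases j <;> simp [twoLevel₁₃] <;>
      first | ring1 | linear_combination h
  · simp [twoLevel₁₃, det_succ_row_zero, Fin.sum_univ_succ, Fin.succAbove]
    linear_combination h

lemma star_twoLevel₁₂ (a b : ℂ) : star (twoLevel₁₂ a b) = twoLevel₁₂ (star a) (-b) := by
  ext i j
  fin_cases i <;> fin_cases j <;> simp [twoLevel₁₂]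

lemma twoLevel₁₂_mem_specialUnitaryGroup (hab : ‖a‖ ^ 2 + ‖b‖ ^ 2 = 1) :
    twoLevel₁₂ a b ∈ specialUnitaryGroup (Fin 4) ℂ := by
  have h : starRingEnd ℂ a * a + starRingEnd ℂ b * b = 1 := by
    simp only [conj_mul']; exact_mod_cast hab
  refine mem_specialUnitaryGroup_iff.2 ⟨mem_unitaryGroup_iff'.2 ?_, ?_⟩
  · rw [star_twoLevel₁₂, twoLevel₁₂_mul]
    ext i j
    fin_cases i <;> fin_cases j <;> simp [twoLevel₁₂] <;>
      first | ring1 | linear_combination h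
  · simp [twoLevel₁₂, det_succ_row_zero, Fin.sum_univ_succ, Fin.succAbove]
    linear_combination h

/-- Givens elimination: the two-level special unitary matrices generate the block matrices
`diag(1, V)` with `V ∈ SU(3)`. -/
lemma mem_of_twoLevel_mem {S : Submonoid (Matrix (Fin 4) (Fin 4) ℂ)}
    (h₂₃ : ∀ a b : ℂ, ‖a‖ ^ 2 + ‖b‖ ^ 2 = 1 → twoLevel₂₃ a b ∈ S)
    (h₁₃ : ∀ a b : ℂ, ‖a‖ ^ 2 + ‖b‖ ^ 2 = 1 → twoLevel₁₃ a b ∈ S)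
    (h₁₂ : ∀ a b : ℂ, ‖a‖ ^ 2 + ‖b‖ ^ 2 = 1 → twoLevel₁₂ a b ∈ S)
    {X : Matrix (Fin 4) (Fin 4) ℂ} (hX : X ∈ specialUnitaryGroup (Fin 4) ℂ) (h00 : X 0 0 = 1) :
    X ∈ S := by
  have of_mul {k X : Matrix (Fin 4) (Fin 4) ℂ} (hk : k ∈ specialUnitaryGroup (Fin 4) ℂ)
      (hkS : star k ∈ S) (h : k * X ∈ S) : X ∈ S := by
    have := S.mul_mem hkS h
    rwa [← mul_assoc, mem_unitaryGroup_iff'.1 (mem_specialUnitaryGroup_iff.1 hk).1,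
      one_mul] at this
  have norm_star {a b : ℂ} (hab : ‖a‖ ^ 2 + ‖b‖ ^ 2 = 1) : ‖star a‖ ^ 2 + ‖-b‖ ^ 2 = 1 := by
    simpa using hab
  obtain ⟨a, b, hab, h23, -⟩ := exists_rotation_to_axis (X 2 3) (X 3 3)
  have hk := twoLevel₂₃_mem_specialUnitaryGroup hab
  refine of_mul hk (star_twoLevel₂₃ a b ▸ h₂₃ _ _ (norm_star hab)) ?_
  replace hX := mul_mem hk hX
  replace h00 : (twoLevel₂₃ a b * X) 0 0 = 1 := by simpa [twoLevel₂₃_mul] using h00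
  replace h23 : (twoLevel₂₃ a b * X) 2 3 = 0 := by simpa [twoLevel₂₃_mul] using h23
  generalize twoLevel₂₃ a b * X = Y at *
  clear hk hab
  obtain ⟨a, b, hab, h13, r, hr, h33⟩ := exists_rotation_to_axis (Y 1 3) (Y 3 3)
  have hk := twoLevel₁₃_mem_specialUnitaryGroup hab
  refine of_mul hk (star_twoLevel₁₃ a b ▸ h₁₃ _ _ (norm_star hab)) ?_
  replace hX := mul_mem hk hX
  replace h00 : (twoLevel₁₃ a b * Y) 0 0 = 1 := by simpa [twoLevel₁₃_mul] using h00
  replace h23 : (twoLevel₁₃ a b * Y) 2 3 = 0 := by simpa [twoLevel₁₃_mul] using h23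
  replace h13 : (twoLevel₁₃ a b * Y) 1 3 = 0 := by simpa [twoLevel₁₃_mul] using h13
  replace h33 : (twoLevel₁₃ a b * Y) 3 3 = r := by simpa [twoLevel₁₃_mul] using h33
  generalize twoLevel₁₃ a b * Y = Z at *
  clear hk hab
  have hZ := (mem_specialUnitaryGroup_iff.1 hX).1
  replace h33 : Z 3 3 = 1 := apply_eq_one_of_mem_unitaryGroup hZ hr h33 fun j hj => by
    fin_cases j
    · exact (apply_eq_zero_of_mem_unitaryGroup hZ h00 (by decide)).1
    · exact h13
    · exact h23
    · exact absurd rfl hj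
  obtain ⟨a, b, hab, h12, r, hr, h22⟩ := exists_rotation_to_axis (Z 1 2) (Z 2 2)
  have hk := twoLevel₁₂_mem_specialUnitaryGroup hab
  refine of_mul hk (star_twoLevel₁₂ a b ▸ h₁₂ _ _ (norm_star hab)) ?_
  replace hX := mul_mem hk hX
  replace h00 : (twoLevel₁₂ a b * Z) 0 0 = 1 := by simpa [twoLevel₁₂_mul] using h00
  replace h33 : (twoLevel₁₂ a b * Z) 3 3 = 1 := by simpa [twoLevel₁₂_mul] using h33
  replace h12 : (twoLevel₁₂ a b * Z) 1 2 = 0 := by simpa [twoLevel₁₂_mul] using h12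
  replace h22 : (twoLevel₁₂ a b * Z) 2 2 = r := by simpa [twoLevel₁₂_mul] using h22
  generalize twoLevel₁₂ a b * Z = D at *
  obtain ⟨hD, hdet⟩ := mem_specialUnitaryGroup_iff.1 hX
  replace h22 : D 2 2 = 1 := apply_eq_one_of_mem_unitaryGroup hD hr h22 fun j hj => by
    fin_cases j
    · exact (apply_eq_zero_of_mem_unitaryGroup hD h00 (by decide)).1
    · exact h12
    · exact absurd rfl hj
    · exact (apply_eq_zero_of_mem_unitaryGroup hD h33 (by decide)).1
  have hdiag : D = diagonal ![1, D 1 1, 1, 1] := by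
    have h0 {j : Fin 4} (hj : j ≠ 0) := apply_eq_zero_of_mem_unitaryGroup hD h00 hj
    have h2 {j : Fin 4} (hj : j ≠ 2) := apply_eq_zero_of_mem_unitaryGroup hD h22 hj
    have h3 {j : Fin 4} (hj : j ≠ 3) := apply_eq_zero_of_mem_unitaryGroup hD h33 hj
    ext i j
    fin_cases i <;> fin_cases j <;> simp [h0, h2, h3, h00, h22, h33]
  have h11 : D 1 1 = 1 := by
    rw [hdiag, det_diagonal] at hdet
    simpa [Fin.prod_univ_four] using hdet
  have hone : D = 1 := by
    rw [hdiag, h11]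
    ext i j
    fin_cases i <;> fin_cases j <;> simp
  exact hone ▸ S.one_mem

end Givens

/-- The closure of the group generated by `Λ₁(σ_x^{1/2})`, `Λ₁(σ_z^{1/2})` and `S`
contains every unitary of the block form `diag(1, V)` with `V ∈ SU(3)`. -/
theorem stmt1 (W : Matrix (Fin 4) (Fin 4) ℂ)
    (hW : W ∈ Matrix.unitaryGroup (Fin 4) ℂ)
    (h00 : W 0 0 = 1)
    (hrow : ∀ j : Fin 4, j ≠ 0 → W 0 j = 0 ∧ W j 0 = 0)
    (hdet : W.det = 1) :
    W ∈ closure ((Submonoid.closure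
      ({cSqrtX, cSqrtZ, swapGate, cSqrtX⁻¹, cSqrtZ⁻¹, swapGate⁻¹} :
        Set (Matrix (Fin 4) (Fin 4) ℂ)) : Submonoid (Matrix (Fin 4) (Fin 4) ℂ)) :
          Set (Matrix (Fin 4) (Fin 4) ℂ)) := by
  let S := (Submonoid.closure
    ({cSqrtX, cSqrtZ, swapGate, cSqrtX⁻¹, cSqrtZ⁻¹, swapGate⁻¹} :
      Set (Matrix (Fin 4) (Fin 4) ℂ))).topologicalClosure
  have hS : IsClosed (S : Set (Matrix (Fin 4) (Fin 4) ℂ)) :=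
    Submonoid.isClosed_topologicalClosure _
  have hX : cSqrtX ∈ S := Submonoid.le_topologicalClosure _ (Submonoid.subset_closure (by simp))
  have hZ : cSqrtZ ∈ S := Submonoid.le_topologicalClosure _ (Submonoid.subset_closure (by simp))
  have hs : swapGate ∈ S := Submonoid.le_topologicalClosure _ (Submonoid.subset_closure (by simp))
  have h₂₃ (a b : ℂ) (hab : ‖a‖ ^ 2 + ‖b‖ ^ 2 = 1) : twoLevel₂₃ a b ∈ S :=
    twoLevel₂₃_mem hS hX hZ hs hab
  have h₁₃ (a b : ℂ) (hab : ‖a‖ ^ 2 + ‖b‖ ^ 2 = 1) : twoLevel₁₃ a b ∈ S :=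
    twoLevel₁₃_eq a b ▸ S.mul_mem (S.mul_mem hs (h₂₃ a b hab)) hs
  have h₁₂ (a b : ℂ) (hab : ‖a‖ ^ 2 + ‖b‖ ^ 2 = 1) : twoLevel₁₂ a b ∈ S :=
    twoLevel₁₂_eq a b ▸ S.mul_mem (S.mul_mem (S.pow_mem hX 2) (h₁₃ a b hab)) (S.pow_mem hX 2)
  exact mem_of_twoLevel_mem h₂₃ h₁₃ h₁₂ (mem_specialUnitaryGroup_iff.2 ⟨hW, hdet⟩) h00
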